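/- arXiv:1907.00858 — 2 statements merged into one kernel-verified Lean document; each statement's English description precedes it below -/
import Mathlib

section
/- With the endomorphisms Γ_s, Γ_r of 𝔐 as defined, both satisfy the quadratic relation Γ ∘ Γ = (q−1)·Γ + q·id, and they satisfy the braid relation of length d: the alternating composition ⋯ Γ_s ∘ Γ_r ∘ Γ_s with d factors equals the alternating composition ⋯ Γ_r ∘ Γ_s ∘ Γ_r with d factors. Consequently 𝔐 is a module over the Hecke algebra of the dihedral Coxeter group with m(s,r) = d, with T_s and T_r acting as Γ_s and Γ_r. -/
noncomputable section

/-- The ring `ℤ[q^{1/2}, q^{-1/2}]`, realized as Laurent polynomials in `T = q^{1/2}`. -/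
abbrev Rq : Type := LaurentPolynomial ℤ

/-- The element `q = (q^{1/2})²`. -/
def qq : Rq := LaurentPolynomial.T 2

/-- The free `Rq`-module `𝔐` with basis `m_0, …, m_{d-1}`. -/
abbrev FM (d : ℕ) : Type := Fin d →₀ Rq

/-- Basis vector `m_p`. -/
def m {d : ℕ} (p : Fin d) : FM d := Finsupp.single p 1

/-- Value of `Γ_s` on the basis vector `m_p`. -/
def GsB (d : ℕ) (x : Rq) (p : Fin d) : FM d :=
  if Odd p.val then
    m ⟨p.val - 1, by have := p.isLt; omega⟩
  else if h : p.val < d - 1 then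
    qq • m ⟨p.val + 1, by have := p.isLt; omega⟩ + (qq - 1) • m p
  else x • m p

/-- Value of `Γ_r` on the basis vector `m_p`. -/
def GrB (d : ℕ) (x : Rq) (p : Fin d) : FM d :=
  if Even p.val ∧ 0 < p.val then
    m ⟨p.val - 1, by have := p.isLt; omega⟩
  else if h : Odd p.val ∧ p.val < d - 1 then
    qq • m ⟨p.val + 1, by have := p.isLt; omega⟩ + (qq - 1) • m p
  else x • m p

/-- The endomorphism `Γ_s` of `𝔐`, as an element of the endomorphism monoid. -/
def Gs (d : ℕ) (x : Rq) : Module.End Rq (FM d) := Finsupp.linearCombination Rq (GsB d x)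

/-- The endomorphism `Γ_r` of `𝔐`. -/
def Gr (d : ℕ) (x : Rq) : Module.End Rq (FM d) := Finsupp.linearCombination Rq (GrB d x)

/-- The alternating product `⋯ A * B * A` with `n` factors (rightmost factor `A`). -/
def altProd {E : Type*} [Monoid E] (A B : E) : ℕ → E
  | 0 => 1
  | n + 1 => altProd B A n * A

lemma altProd_succ_left {E : Type*} [Monoid E] (A B : E) (n : ℕ) :
    altProd A B (n + 1) = (if Even n then A else B) * altProd A B n := by
  induction n generalizing A B with
  | zero => simp [altProd]
  | succ n ih =>
    rw [altProd, ih B A, mul_assoc]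
    by_cases h : Even n <;> simp [altProd, Nat.even_add_one, h]

/-- If `A` and `B` satisfy the same quadratic relation, the locus where the two alternating
products of a given positive length agree is stable under `A`. -/
lemma altProd_apply_eq_of_quadratic {R M : Type*} [CommRing R] [AddCommGroup M] [Module R M]
    {a b : R} {A B : Module.End R M} (hA : A * A = a • A + b • (1 : Module.End R M))
    (hB : B * B = a • B + b • (1 : Module.End R M)) (n : ℕ) {v : M}
    (hv : altProd A B (n + 1) v = altProd B A (n + 1) v) :
    altProd A B (n + 1) (A v) = altProd B A (n + 1) (A v) := by
  obtain ⟨t, ht, h₁, h₂⟩ : ∃ t : Module.End R M, t * t = a • t + b • (1 : Module.End R M) ∧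
      altProd B A (n + 1) = t * altProd B A n ∧
      altProd A B (n + 2) = t * altProd A B (n + 1) := by
    refine ⟨if Even n then B else A, ?_, altProd_succ_left B A n, ?_⟩
    · split_ifs
      exacts [hB, hA]
    · rw [altProd_succ_left A B (n + 1)]
      by_cases h : Even n <;> simp [Nat.even_add_one, h]
  have hleft : altProd A B (n + 1) * A = a • altProd A B (n + 1) + b • altProd B A n := by
    simp only [altProd]
    rw [mul_assoc, hA, mul_add, mul_smul_comm, mul_smul_comm, mul_one]
  have hright : t * altProd B A (n + 1) = a • altProd B A (n + 1) + b • altProd B A n := by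
    rw [h₁, ← mul_assoc, ht, add_mul, smul_mul_assoc, smul_mul_assoc, one_mul]
  calc altProd A B (n + 1) (A v) = (altProd A B (n + 1) * A) v := rfl
    _ = (t * altProd B A (n + 1)) v := by
      rw [hleft, hright]
      simp [hv]
    _ = (t * altProd A B (n + 1)) v := by
      rw [Module.End.mul_apply, Module.End.mul_apply, hv]
    _ = altProd B A (n + 1) (A v) := by
      rw [← h₂]
      rfl

lemma Gs_m (d : ℕ) (x : Rq) (p : Fin d) : Gs d x (m p) = GsB d x p := by
  simp [Gs, m]

lemma Gr_m (d : ℕ) (x : Rq) (p : Fin d) : Gr d x (m p) = GrB d x p := by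
  simp [Gr, m]

lemma FM_end_ext {d : ℕ} {f g : Module.End Rq (FM d)} (h : ∀ p, f (m p) = g (m p)) : f = g :=
  Finsupp.lhom_ext' fun p => LinearMap.ext_ring (h p)

lemma Gs_m_odd {d : ℕ} (x : Rq) {p : ℕ} (hp : p + 1 < d) (h : Even p) :
    Gs d x (m ⟨p + 1, hp⟩) = m ⟨p, by omega⟩ := by
  rw [Gs_m, GsB, if_pos (show Odd (p + 1) from h.add_one)]
  rfl

lemma Gs_m_even {d : ℕ} (x : Rq) {p : ℕ} (hp : p + 1 < d) (h : Even p) :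
    Gs d x (m ⟨p, by omega⟩) = qq • m ⟨p + 1, hp⟩ + (qq - 1) • m ⟨p, by omega⟩ := by
  rw [Gs_m, GsB, if_neg (show ¬ Odd p by simpa using h), dif_pos (show p < d - 1 by omega)]

lemma Gs_m_last {d : ℕ} (x : Rq) {p : ℕ} (hp : p + 1 = d) (h : Even p) :
    Gs d x (m ⟨p, by omega⟩) = x • m ⟨p, by omega⟩ := by
  rw [Gs_m, GsB, if_neg (show ¬ Odd p by simpa using h), dif_neg (show ¬ p < d - 1 by omega)]

lemma Gr_m_even {d : ℕ} (x : Rq) {p : ℕ} (hp : p + 1 < d) (h : Odd p) :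
    Gr d x (m ⟨p + 1, hp⟩) = m ⟨p, by omega⟩ := by
  rw [Gr_m, GrB, if_pos (show Even (p + 1) ∧ 0 < p + 1 from ⟨h.add_one, p.succ_pos⟩)]
  rfl

lemma Gr_m_odd {d : ℕ} (x : Rq) {p : ℕ} (hp : p + 1 < d) (h : Odd p) :
    Gr d x (m ⟨p, by omega⟩) = qq • m ⟨p + 1, hp⟩ + (qq - 1) • m ⟨p, by omega⟩ := by
  rw [Gr_m, GrB, if_neg (show ¬ (Even p ∧ 0 < p) by simp [h]),
    dif_pos (show Odd p ∧ p < d - 1 from ⟨h, by omega⟩)]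

lemma Gr_m_last {d : ℕ} (x : Rq) {p : ℕ} (hp : p + 1 = d) (h : Odd p) :
    Gr d x (m ⟨p, by omega⟩) = x • m ⟨p, by omega⟩ := by
  rw [Gr_m, GrB, if_neg (show ¬ (Even p ∧ 0 < p) by simp [h]),
    dif_neg (show ¬ (Odd p ∧ p < d - 1) by omega)]

lemma Gr_m_zero {d : ℕ} (x : Rq) (hd : 0 < d) :
    Gr d x (m ⟨0, hd⟩) = x • m ⟨0, hd⟩ := by
  rw [Gr_m, GrB, if_neg (by simp), dif_neg (by simp)]

lemma mul_self_of_eq_qq_or_neg_one {x : Rq} (hx : x = qq ∨ x = -1) :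
    x * x = (qq - 1) * x + qq := by
  rcases hx with rfl | rfl <;> ring

lemma Gs_mul_self (d : ℕ) {x : Rq} (hx : x = qq ∨ x = -1) :
    Gs d x * Gs d x = (qq - 1) • Gs d x + qq • (1 : Module.End Rq (FM d)) := by
  refine FM_end_ext fun ⟨p, hp⟩ => ?_
  simp only [Module.End.mul_apply, LinearMap.add_apply, LinearMap.smul_apply, Module.End.one_apply]
  rcases Nat.even_or_odd p with h | h
  · rcases (show p + 1 < d ∨ p + 1 = d by omega) with h' | h'
    · rw [Gs_m_even x h' h, map_add, map_smul, map_smul, Gs_m_odd x h' h, Gs_m_even x h' h,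
        add_comm]
    · rw [Gs_m_last x h' h, map_smul, Gs_m_last x h' h, smul_smul, smul_smul, ← add_smul,
        mul_self_of_eq_qq_or_neg_one hx]
  · obtain ⟨k, rfl⟩ := h
    rw [Gs_m_odd x hp (even_two_mul k), Gs_m_even x hp (even_two_mul k), add_comm]

lemma Gr_mul_self (d : ℕ) {x : Rq} (hx : x = qq ∨ x = -1) :
    Gr d x * Gr d x = (qq - 1) • Gr d x + qq • (1 : Module.End Rq (FM d)) := by
  refine FM_end_ext fun ⟨p, hp⟩ => ?_
  simp only [Module.End.mul_apply, LinearMap.add_apply, LinearMap.smul_apply, Module.End.one_apply]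
  rcases Nat.even_or_odd p with h | h
  · rcases p with _ | p
    · rw [Gr_m_zero, map_smul, Gr_m_zero, smul_smul, smul_smul, ← add_smul,
        mul_self_of_eq_qq_or_neg_one hx]
    · have h' : Odd p := by simpa [Nat.even_add_one] using h
      rw [Gr_m_even x hp h', Gr_m_odd x hp h', add_comm]
  · rcases (show p + 1 < d ∨ p + 1 = d by omega) with h' | h'
    · rw [Gr_m_odd x h' h, map_add, map_smul, map_smul, Gr_m_even x h' h, Gr_m_odd x h' h,
        add_comm]
    · rw [Gr_m_last x h' h, map_smul, Gr_m_last x h' h, smul_smul, smul_smul, ← add_smul,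
        mul_self_of_eq_qq_or_neg_one hx]

/-- The generator lowering `m_p` (for `p > 0`): `Γ_s` for odd `p` and `Γ_r` for even `p`. -/
def lowering (d : ℕ) (x : Rq) (p : ℕ) : Module.End Rq (FM d) :=
  if Even p then Gr d x else Gs d x

lemma lowering_add_two (d : ℕ) (x : Rq) (p : ℕ) : lowering d x (p + 2) = lowering d x p := by
  simp [lowering, Nat.even_add]

lemma lowering_m_succ {d : ℕ} (x : Rq) {p : ℕ} (hp : p + 1 < d) :
    lowering d x (p + 1) (m ⟨p + 1, hp⟩) = m ⟨p, by omega⟩ := by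
  rcases Nat.even_or_odd p with h | h
  · rw [lowering, if_neg (by simp [Nat.even_add_one, h]), Gs_m_odd x hp h]
  · rw [lowering, if_pos h.add_one, Gr_m_even x hp h]

lemma lowering_succ_m_last {d : ℕ} (x : Rq) {p : ℕ} (hp : p + 1 = d) :
    lowering d x (p + 1) (m ⟨p, by omega⟩) = x • m ⟨p, by omega⟩ := by
  rcases Nat.even_or_odd p with h | h
  · rw [lowering, if_neg (by simp [Nat.even_add_one, h]), Gs_m_last x hp h]
  · rw [lowering, if_pos h.add_one, Gr_m_last x hp h]

lemma altProd_lowering_m {d : ℕ} (x : Rq) {p : ℕ} (hp : p < d) :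
    altProd (lowering d x p) (lowering d x (p + 1)) p (m ⟨p, hp⟩) = m ⟨0, by omega⟩ := by
  induction p with
  | zero => rfl
  | succ p ih =>
    rw [altProd, Module.End.mul_apply, lowering_m_succ, lowering_add_two, ih]

lemma altProd_succ_lowering_m {d : ℕ} (x : Rq) {p : ℕ} (hp : p < d) :
    altProd (lowering d x p) (lowering d x (p + 1)) (p + 1) (m ⟨p, hp⟩) =
      x • m ⟨0, by omega⟩ := by
  induction p with
  | zero => simp [altProd, lowering, Gr_m_zero]
  | succ p ih =>
    rw [altProd, Module.End.mul_apply, lowering_m_succ, lowering_add_two, ih]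

lemma altProd_lowering_braid (n : ℕ) {x : Rq} (hx : x = qq ∨ x = -1) :
    altProd (lowering (n + 1) x n) (lowering (n + 1) x (n + 1)) (n + 1) =
      altProd (lowering (n + 1) x (n + 1)) (lowering (n + 1) x n) (n + 1) := by
  have hquad (p : ℕ) : lowering (n + 1) x p * lowering (n + 1) x p =
      (qq - 1) • lowering (n + 1) x p + qq • (1 : Module.End Rq (FM (n + 1))) := by
    rw [lowering]
    split_ifs
    exacts [Gr_mul_self _ hx, Gs_mul_self _ hx]
  have hstable (p : ℕ) {v : FM (n + 1)}
      (hv : altProd (lowering (n + 1) x n) (lowering (n + 1) x (n + 1)) (n + 1) v =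
        altProd (lowering (n + 1) x (n + 1)) (lowering (n + 1) x n) (n + 1) v) :
      altProd (lowering (n + 1) x n) (lowering (n + 1) x (n + 1)) (n + 1)
          (lowering (n + 1) x p v) =
        altProd (lowering (n + 1) x (n + 1)) (lowering (n + 1) x n) (n + 1)
          (lowering (n + 1) x p v) := by
    have hcases : lowering (n + 1) x p = lowering (n + 1) x n ∨
        lowering (n + 1) x p = lowering (n + 1) x (n + 1) := by
      by_cases hp : Even p <;> by_cases hn : Even n <;>
        simp [lowering, Nat.even_add_one, hp, hn]
    rcases hcases with h | h <;> rw [h]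
    · exact altProd_apply_eq_of_quadratic (hquad _) (hquad _) n hv
    · exact (altProd_apply_eq_of_quadratic (hquad _) (hquad _) n hv.symm).symm
  refine FM_end_ext fun ⟨p, hp⟩ => ?_
  induction Nat.le_of_lt_succ hp using Nat.decreasingInduction with
  | self =>
    rw [altProd_succ_lowering_m, altProd, Module.End.mul_apply, lowering_succ_m_last x rfl,
      map_smul, altProd_lowering_m]
  | of_succ p hpn ih =>
    rw [← lowering_m_succ x (Nat.succ_lt_succ hpn)]
    exact hstable _ (ih _)

/-- The endomorphisms `Γ_s` and `Γ_r` satisfy the quadratic relation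
`Γ² = (q-1)·Γ + q·id` and the braid relation of length `d` (alternating composition of
`d` factors); these are exactly the defining relations of the Hecke algebra of the
dihedral Coxeter group with `m(s,r) = d`, so `𝔐` is a module over that Hecke algebra
with `T_s` and `T_r` acting as `Γ_s` and `Γ_r`. -/
theorem stmt6 (d : ℕ) (hd : 1 ≤ d) (x : Rq) (hx : x = qq ∨ x = -1) :
    Gs d x * Gs d x = (qq - 1) • Gs d x + qq • (1 : Module.End Rq (FM d)) ∧
    Gr d x * Gr d x = (qq - 1) • Gr d x + qq • (1 : Module.End Rq (FM d)) ∧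
    altProd (Gs d x) (Gr d x) d = altProd (Gr d x) (Gs d x) d := by
  obtain ⟨n, rfl⟩ := Nat.exists_eq_add_of_le' hd
  refine ⟨Gs_mul_self _ hx, Gr_mul_self _ hx, ?_⟩
  have h := altProd_lowering_braid n hx
  by_cases hn : Even n
  · simpa [lowering, Nat.even_add_one, hn] using h.symm
  · simpa [lowering, Nat.even_add_one, hn] using h

end
end

section
/- Let (W, S) be a Coxeter system, H ⊆ S, w ∈ W^H, and let M and N be two H-special matchings of w. Let O be an orbit of the group ⟨M,N⟩ acting on the Bruhat interval [e,w], with minimum 0̂_O and maximum 1̂_O. Then O ∩ W^H is one of the following: the empty set; the entire orbit O; the singleton {0̂_O}; or a saturated chain from 0̂_O to some coatom u of 1̂_O in O, each of whose covering steps x covered by y satisfies y = M(x) or y = N(x). -/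
open Polynomial

section Bruhat

variable {B : Type*} {W : Type*} [Group W] {Mat : CoxeterMatrix B} (cs : CoxeterSystem Mat W)

/-- One step of the Bruhat order on a Coxeter group: multiply on the right by a
reflection and increase the length. -/
def bstep (u v : W) : Prop :=
  (∃ t : W, cs.IsReflection t ∧ v = u * t) ∧ cs.length u < cs.length v

/-- The Bruhat order `≤` on the Coxeter group `W`. -/
def ble (u v : W) : Prop :=
  Relation.ReflTransGen (bstep cs) u v

/-- Strict Bruhat order. -/
def blt (u v : W) : Prop := ble cs u v ∧ u ≠ v

/-- Covering relation of the Bruhat order. -/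
def bcov (u v : W) : Prop :=
  blt cs u v ∧ ∀ z : W, ble cs u z → ble cs z v → z = u ∨ z = v

/-- The set `W^H` of minimal coset representatives:
`w` with `ℓ(w s) > ℓ(w)` for all `s ∈ H`. -/
def WH (H : Set B) : Set W :=
  {w | ∀ i ∈ H, cs.length w < cs.length (w * cs.simple i)}

end Bruhat

section Matchings

variable {B : Type*} {W : Type*} [Group W] {Mat : CoxeterMatrix B} (cs : CoxeterSystem Mat W)

/-- A special matching of the Bruhat interval `[e,w]`, encoded as a total function
`M : W → W` whose values outside `[e,w]` are irrelevant: `M` maps `[e,w]` to itself, is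
an involution there, moves every element to a covered or covering element, and whenever
`u ⋖ v` in `[e,w]` with `M u ≠ v` one has `M u ≤ M v`. -/
def IsSpecialMatching (w : W) (M : W → W) : Prop :=
  (∀ x, ble cs x w → ble cs (M x) w) ∧
  (∀ x, ble cs x w → M (M x) = x) ∧
  (∀ x, ble cs x w → (bcov cs (M x) x ∨ bcov cs x (M x))) ∧
  (∀ u v, ble cs u w → ble cs v w → bcov cs u v → M u ≠ v → ble cs (M u) (M v))

/-- An `H`-special matching: a special matching of `[e,w]` such that
`u ≤ w`, `u ∈ W^H`, `M u ⋖ u` imply `M u ∈ W^H`. -/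
def IsHSpecial (H : Set B) (w : W) (M : W → W) : Prop :=
  IsSpecialMatching cs w M ∧
  ∀ u, ble cs u w → u ∈ WH cs H → bcov cs (M u) u → M u ∈ WH cs H

/-- The orbit of `u` under the group of permutations generated by `M` and `N`. -/
def orbitMN (M N : W → W) (u : W) : Set W :=
  {v | Relation.ReflTransGen (fun a b => M a = b ∨ N a = b) u v}

/-- `x` is covered by `y` inside the subposet induced by the Bruhat order on `O`. -/
def CovInB (O : Set W) (x y : W) : Prop :=
  x ∈ O ∧ y ∈ O ∧ blt cs x y ∧ ∀ z ∈ O, ¬ (blt cs x z ∧ blt cs z y)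

end Matchings

section StrongExchange

variable {B : Type*} {W : Type*} [Group W] {Mat : CoxeterMatrix B} (cs : CoxeterSystem Mat W)

open Classical in
/-- The action of a simple reflection on signed elements: conjugate, and flip the sign exactly
at the simple reflection itself. -/
noncomputable def signedConj (i : B) : Function.End (W × ZMod 2) := fun p =>
  (cs.simple i * p.1 * cs.simple i, p.2 + if p.1 = cs.simple i then 1 else 0)

open Classical in
theorem signedConj_mul_pow_apply (i j : B) (k : ℕ) (x : W) (e : ZMod 2) :
    ((signedConj cs i * signedConj cs j) ^ k) (x, e) =
      ((cs.simple i * cs.simple j) ^ k * x * ((cs.simple i * cs.simple j) ^ k)⁻¹,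
        e + ∑ n ∈ Finset.range (2 * k),
          if x = ((cs.simple i * cs.simple j) ^ n)⁻¹ * cs.simple j then 1 else 0) := by
  set r := cs.simple i * cs.simple j with hr
  have hrinv : r⁻¹ = cs.simple j * cs.simple i := by simp [hr]
  have hconj : ∀ n : ℕ, cs.simple j * r ^ n = (r ^ n)⁻¹ * cs.simple j := by
    intro n
    have h : SemiconjBy (cs.simple j) r r⁻¹ := by
      rw [SemiconjBy, hrinv, hr, mul_assoc]
    rw [← inv_pow]
    exact h.pow_right n
  induction k with
  | zero =>
    change (x, e) = _
    simp
  | succ k ih =>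
    rw [pow_succ']
    change (signedConj cs i * signedConj cs j) (((signedConj cs i * signedConj cs j) ^ k) (x, e)) = _
    rw [ih]
    change signedConj cs i (signedConj cs j _) = _
    have h1 : r ^ k * x * (r ^ k)⁻¹ = cs.simple j ↔ x = (r ^ (2 * k))⁻¹ * cs.simple j := by
      rw [mul_inv_eq_iff_eq_mul, hconj, ← eq_inv_mul_iff_mul_eq, ← mul_assoc, ← mul_inv_rev,
        ← pow_add, two_mul]
    have h2 : cs.simple j * (r ^ k * x * (r ^ k)⁻¹) * cs.simple j = cs.simple i ↔
        x = (r ^ (2 * k + 1))⁻¹ * cs.simple j := by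
      have : cs.simple j * (r ^ k * x * (r ^ k)⁻¹) * cs.simple j = cs.simple i ↔
          r ^ k * x * (r ^ k)⁻¹ = cs.simple j * cs.simple i * cs.simple j := by
        constructor
        · intro h
          rw [← h]
          simp [mul_assoc]
        · intro h
          rw [h]
          simp [mul_assoc]
      have hpow : (r ^ (2 * k + 1))⁻¹ = (r ^ k)⁻¹ * (r⁻¹ * (r ^ k)⁻¹) := by group
      rw [this, ← hrinv, mul_inv_eq_iff_eq_mul, mul_assoc, hconj, ← eq_inv_mul_iff_mul_eq, hpow,
        mul_assoc, mul_assoc]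
    have h3 : 2 * (k + 1) = 2 * k + 1 + 1 := by ring
    rw [h3, Finset.sum_range_succ, Finset.sum_range_succ]
    simp only [signedConj, h1, h2]
    refine Prod.ext ?_ ?_
    · simp [hr, pow_succ', mul_assoc]
    · simp only [add_assoc]

theorem signedConj_isLiftable : Mat.IsLiftable (signedConj cs) := by
  classical
  intro i j
  funext p
  obtain ⟨x, e⟩ := p
  rw [signedConj_mul_pow_apply, cs.simple_mul_simple_pow, two_mul, Finset.sum_range_add]
  have h : ∀ n, (cs.simple i * cs.simple j) ^ (Mat i j + n) = (cs.simple i * cs.simple j) ^ n := by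
    intro n
    rw [pow_add, cs.simple_mul_simple_pow, one_mul]
  simp only [h, CharTwo.add_self_eq_zero]
  change _ = (x, e)
  simp

/-- The parity with which `x` occurs in the right inversion sequence of a word for `w`. -/
noncomputable def invParity (w x : W) : ZMod 2 :=
  (cs.lift ⟨signedConj cs, signedConj_isLiftable cs⟩ w (x, 0)).2

theorem lift_signedConj_apply (w x : W) (e : ZMod 2) :
    cs.lift ⟨signedConj cs, signedConj_isLiftable cs⟩ w (x, e) =
      (w * x * w⁻¹, e + invParity cs w x) := by
  induction w using cs.simple_induction_left generalizing x e with
  | one =>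
    rw [invParity, map_one]
    change (x, e) = (1 * x * 1⁻¹, e + 0)
    simp
  | mul_simple_left w i ih =>
    have h : ∀ e, cs.lift ⟨signedConj cs, signedConj_isLiftable cs⟩ (cs.simple i * w) (x, e) =
        signedConj cs i (w * x * w⁻¹, e + invParity cs w x) := by
      intro e
      rw [map_mul, cs.lift_apply_simple, ← ih]
      rfl
    have h0 : invParity cs (cs.simple i * w) x =
        (signedConj cs i (w * x * w⁻¹, 0 + invParity cs w x)).2 := by
      rw [invParity, h]
    rw [h, h0]
    simp [signedConj, mul_assoc, add_assoc]

theorem invParity_mul (a b x : W) :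
    invParity cs (a * b) x = invParity cs b x + invParity cs a (b * x * b⁻¹) := by
  have h : cs.lift ⟨signedConj cs, signedConj_isLiftable cs⟩ (a * b) (x, 0) =
      cs.lift ⟨signedConj cs, signedConj_isLiftable cs⟩ a
        (cs.lift ⟨signedConj cs, signedConj_isLiftable cs⟩ b (x, 0)) := by
    rw [map_mul]
    rfl
  simp only [lift_signedConj_apply, zero_add] at h
  exact congrArg Prod.snd h

theorem invParity_one (x : W) : invParity cs 1 x = 0 := by
  rw [invParity, map_one]
  rfl

open Classical in
theorem invParity_simple (i : B) (x : W) :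
    invParity cs (cs.simple i) x = if x = cs.simple i then 1 else 0 := by
  simp [invParity, cs.lift_apply_simple, signedConj]

theorem mem_rightInvSeq_of_invParity_ne_zero (ω : List B) (x : W)
    (h : invParity cs (cs.wordProd ω) x ≠ 0) : x ∈ cs.rightInvSeq ω := by
  classical
  induction ω with
  | nil => simp [invParity_one] at h
  | cons i ω ih =>
    rw [cs.wordProd_cons, invParity_mul, invParity_simple] at h
    rw [CoxeterSystem.rightInvSeq, List.mem_cons]
    by_cases hx : cs.wordProd ω * x * (cs.wordProd ω)⁻¹ = cs.simple i
    · left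
      rw [← hx]
      group
    · right
      exact ih (by simpa [hx] using h)

theorem length_mul_lt_of_invParity_ne_zero {w x : W} (h : invParity cs w x ≠ 0) :
    cs.length (w * x) < cs.length w := by
  obtain ⟨ω, hω, rfl⟩ := cs.exists_isReduced w
  exact (cs.isRightInversion_of_mem_rightInvSeq hω
    (mem_rightInvSeq_of_invParity_ne_zero cs ω x h)).2

theorem invParity_self {t : W} (ht : cs.IsReflection t) : invParity cs t t = 1 := by
  classical
  obtain ⟨w, i, rfl⟩ := ht
  have h := invParity_mul cs w w⁻¹ (w * cs.simple i * w⁻¹)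
  have e1 : w⁻¹ * (w * cs.simple i * w⁻¹) * w⁻¹⁻¹ = cs.simple i := by group
  rw [mul_inv_cancel, invParity_one, e1] at h
  rw [invParity_mul, e1, invParity_mul, invParity_simple, if_pos rfl,
    cs.inv_simple, cs.simple_mul_simple_self, one_mul]
  rw [add_left_comm, ← h, add_zero]

theorem invParity_ne_zero_of_length_mul_lt {w t : W} (ht : cs.IsReflection t)
    (h : cs.length (w * t) < cs.length w) : invParity cs w t ≠ 0 := by
  intro h0
  have h1 : invParity cs (w * t) t ≠ 0 := by
    rw [invParity_mul, invParity_self cs ht, mul_inv_cancel_right, h0]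
    simp
  have h2 := length_mul_lt_of_invParity_ne_zero cs h1
  rw [mul_assoc, ht.mul_self, mul_one] at h2
  omega

/-- If right multiplication by a simple reflection reverses the lengths of `u < u * t`, then
`t` is that simple reflection. -/
theorem eq_simple_of_length_mul_simple_lt {u t : W} {i : B} (ht : cs.IsReflection t)
    (hut : cs.length u < cs.length (u * t))
    (h : cs.length (u * t * cs.simple i) < cs.length (u * cs.simple i)) : t = cs.simple i := by
  classical
  have ht' : cs.IsReflection (cs.simple i * t * (cs.simple i)⁻¹) := ht.conj _
  have h1 : invParity cs (u * cs.simple i) (cs.simple i * t * (cs.simple i)⁻¹) ≠ 0 := by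
    apply invParity_ne_zero_of_length_mul_lt cs ht'
    convert h using 2
    simp [mul_assoc]
  have h2 : invParity cs u t = 0 := by
    by_contra h3
    have := length_mul_lt_of_invParity_ne_zero cs h3
    omega
  have h4 : cs.simple i * (cs.simple i * t * (cs.simple i)⁻¹) * (cs.simple i)⁻¹ = t := by
    simp [mul_assoc]
  rw [invParity_mul, h4, h2, add_zero, invParity_simple] at h1
  have h5 : cs.simple i * t * (cs.simple i)⁻¹ = cs.simple i := by
    by_contra hne
    exact h1 (if_neg hne)
  rw [mul_inv_eq_iff_eq_mul] at h5
  exact mul_left_cancel h5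

end StrongExchange

section BruhatOrder

variable {B : Type*} {W : Type*} [Group W] {Mat : CoxeterMatrix B} {cs : CoxeterSystem Mat W}

theorem ble_trans {u v x : W} (h : ble cs u v) (h' : ble cs v x) : ble cs u x :=
  Relation.ReflTransGen.trans h h'

theorem length_lt_of_blt {u v : W} (h : blt cs u v) : cs.length u < cs.length v := by
  obtain ⟨h, hne⟩ := h
  have key : u = v ∨ cs.length u < cs.length v := by
    induction h with
    | refl => exact Or.inl rfl
    | @tail b c _ hs ih =>
      by_cases hu : u = b
      · exact Or.inr (hu ▸ hs.2)
      · exact Or.inr ((ih hu |>.resolve_left hu).trans hs.2)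
  exact key.resolve_left hne

theorem length_le_of_ble {u v : W} (h : ble cs u v) : cs.length u ≤ cs.length v := by
  by_cases hne : u = v
  · rw [hne]
  · exact (length_lt_of_blt ⟨h, hne⟩).le

theorem blt_of_bstep {u v : W} (h : bstep cs u v) : blt cs u v :=
  ⟨Relation.ReflTransGen.single h, fun e => by have := h.2; rw [e] at this; omega⟩

theorem bstep_of_bcov {u v : W} (h : bcov cs u v) : bstep cs u v := by
  obtain ⟨⟨hle, hne⟩, hcov⟩ := h
  obtain heq | ⟨z, hz, hzv⟩ := Relation.ReflTransGen.cases_tail hle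
  · exact absurd heq.symm hne
  · obtain rfl | rfl := hcov z hz (.single hzv)
    · exact hzv
    · exact absurd rfl (blt_of_bstep hzv).2

theorem bcov.ble {u v : W} (h : bcov cs u v) : ble cs u v := h.1.1

theorem bcov.length_lt {u v : W} (h : bcov cs u v) : cs.length u < cs.length v :=
  length_lt_of_blt h.1

theorem exists_bcov_of_blt {u p : W} (h : blt cs u p) : ∃ q, ble cs u q ∧ bcov cs q p := by
  classical
  let P : ℕ → Prop := fun n => ∃ q, ble cs u q ∧ blt cs q p ∧ cs.length q = n
  have hb : ∀ n, P n → n ≤ cs.length p := by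
    rintro n ⟨q, -, hq, rfl⟩
    exact (length_lt_of_blt hq).le
  have h0 : P (cs.length u) := ⟨u, .refl, h, rfl⟩
  obtain ⟨q, huq, hqp, hq⟩ := Nat.findGreatest_spec (hb _ h0) h0
  refine ⟨q, huq, hqp, fun z hqz hzp => ?_⟩
  by_contra! hne
  have hz : P (cs.length z) := ⟨z, ble_trans huq hqz, ⟨hzp, hne.2⟩, rfl⟩
  have h1 := Nat.le_findGreatest (hb _ hz) hz
  have h2 := length_lt_of_blt ⟨hqz, hne.1.symm⟩
  omega

/-- If `u ⋖ v` and `s` is a right descent of `v`, then `u = v s` or `s` is a right descent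
of `u`. -/
theorem eq_mul_simple_or_descent_of_bcov {u v : W} (h : bcov cs u v) {i : B}
    (hi : cs.length (v * cs.simple i) < cs.length v) :
    u = v * cs.simple i ∨ cs.length (u * cs.simple i) < cs.length u := by
  obtain ⟨⟨t, ht, rfl⟩, hlt⟩ := bstep_of_bcov h
  by_contra! hcon
  obtain ⟨hne, hle⟩ := hcon
  have hs := cs.isReflection_simple i
  have hu : cs.length u < cs.length (u * cs.simple i) :=
    lt_of_le_of_ne hle (hs.length_mul_left_ne u).symm
  have hrefl : cs.IsReflection (cs.simple i * t * (cs.simple i)⁻¹) := ht.conj _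
  have hmul : u * t * cs.simple i = u * cs.simple i * (cs.simple i * t * (cs.simple i)⁻¹) := by
    simp [mul_assoc]
  have hd := hrefl.length_mul_left_ne (u * cs.simple i)
  rw [← hmul] at hd
  obtain hlt' | hlt' := lt_or_gt_of_ne hd
  · have := eq_simple_of_length_mul_simple_lt cs ht hlt hlt'
    apply hne
    rw [this, mul_assoc, cs.simple_mul_simple_self, mul_one]
  · have h1 : bstep cs u (u * cs.simple i) := ⟨⟨_, hs, rfl⟩, hu⟩
    have h2 : bstep cs (u * cs.simple i) (u * t * cs.simple i) := ⟨⟨_, hrefl, hmul⟩, hlt'⟩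
    have h3 : bstep cs (u * t * cs.simple i) (u * t) :=
      ⟨⟨_, hs, by rw [mul_assoc, cs.simple_mul_simple_self, mul_one]⟩, hi⟩
    obtain h4 | h4 := h.2 _ (.single h1) (.tail (.single h2) h3)
    · rw [h4] at hu
      omega
    · rw [h4] at hlt'
      omega

theorem exists_descent_of_notMem_WH {H : Set B} {v : W} (h : v ∉ WH cs H) :
    ∃ i ∈ H, cs.length (v * cs.simple i) < cs.length v := by
  by_contra! hcon
  exact h fun i hi => lt_of_le_of_ne (hcon i hi)
    ((cs.isReflection_simple i).length_mul_left_ne v).symm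

theorem eq_mul_simple_of_bcov_of_mem_WH {H : Set B} {u v : W} (h : bcov cs u v)
    (hu : u ∈ WH cs H) {i : B} (hi : i ∈ H)
    (hv : cs.length (v * cs.simple i) < cs.length v) : u = v * cs.simple i := by
  have := hu i hi
  exact (eq_mul_simple_or_descent_of_bcov h hv).resolve_right (by omega)

/-- An element covering two distinct elements of `W^H` lies in `W^H`. -/
theorem mem_WH_of_bcov_of_bcov {H : Set B} {y z v : W} (hyz : y ≠ z) (hy : bcov cs y v)
    (hz : bcov cs z v) (hyH : y ∈ WH cs H) (hzH : z ∈ WH cs H) : v ∈ WH cs H := by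
  by_contra hv
  obtain ⟨i, hi, hlt⟩ := exists_descent_of_notMem_WH hv
  exact hyz ((eq_mul_simple_of_bcov_of_mem_WH hy hyH hi hlt).trans
    (eq_mul_simple_of_bcov_of_mem_WH hz hzH hi hlt).symm)

/-- A cover of `y` and `z` outside `W^H` is determined by the lower elements `x ⋖ z` and `y`
when `x, y` lie in `W^H` and `z` does not. -/
theorem mul_eq_of_bcov_of_notMem_WH {H : Set B} {x y z v : W} (hxz : bcov cs x z)
    (hyv : bcov cs y v) (hzv : bcov cs z v) (hx : x ∈ WH cs H) (hy : y ∈ WH cs H)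
    (hz : z ∉ WH cs H) (hv : v ∉ WH cs H) : v = y * (x⁻¹ * z) := by
  obtain ⟨i, hi, hlt⟩ := exists_descent_of_notMem_WH hv
  have h1 := eq_mul_simple_of_bcov_of_mem_WH hyv hy hi hlt
  have h2 : z ≠ v * cs.simple i := fun h => hz (by rw [h, ← h1]; exact hy)
  have h3 := (eq_mul_simple_or_descent_of_bcov hzv hlt).resolve_left h2
  have h4 := eq_mul_simple_of_bcov_of_mem_WH hxz hx hi h3
  rw [h1, h4]
  simp [mul_assoc]

end BruhatOrder

section SpecialMatching

variable {B : Type*} {W : Type*} [Group W] {Mat : CoxeterMatrix B} {cs : CoxeterSystem Mat W}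
  {w : W} {M : W → W}

/-- The lifting property of special matchings. -/
theorem IsSpecialMatching.ble_apply (hM : IsSpecialMatching cs w M) {u p : W}
    (hup : ble cs u p) (hp : ble cs p w) (hu : bcov cs u (M u)) : ble cs u (M p) := by
  induction hn : cs.length p using Nat.strong_induction_on generalizing p with
  | _ n ih =>
    by_cases hne : u = p
    · rw [← hne]
      exact hu.ble
    obtain ⟨q, huq, hqp⟩ := exists_bcov_of_blt ⟨hup, hne⟩
    have hqw : ble cs q w := ble_trans hqp.ble hp
    by_cases hMq : M q = p
    · rwa [← hMq, hM.2.1 q hqw]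
    · exact ble_trans (ih _ (hn ▸ hqp.length_lt) huq hqw rfl) (hM.2.2.2 q p hqw hp hqp hMq)

theorem IsSpecialMatching.bcov_of_bcov (hM : IsSpecialMatching cs w M) {u v : W}
    (hv : ble cs v w) (huv : bcov cs u v) (hu : bcov cs u (M u)) (hne : M u ≠ v) :
    bcov cs v (M v) ∧ bcov cs (M u) (M v) := by
  have huw : ble cs u w := ble_trans huv.ble hv
  have hMvw := hM.1 v hv
  have hle : ble cs (M u) (M v) := hM.2.2.2 u v huw hv huv hne
  have hMne : M u ≠ M v := fun h => huv.1.2 (by rw [← hM.2.1 u huw, h, hM.2.1 v hv])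
  have hvM : bcov cs v (M v) := by
    refine (hM.2.2.1 v hv).resolve_left fun h => ?_
    obtain h1 | h1 := huv.2 (M u) hu.ble (ble_trans hle h.ble)
    · exact hu.1.2 h1.symm
    · exact hne h1
  refine ⟨hvM, ⟨hle, hMne⟩, fun p hp1 hp2 => ?_⟩
  have hpw : ble cs p w := ble_trans hp2 hMvw
  have hup : ble cs u p := ble_trans hu.ble hp1
  obtain h | h := hM.2.2.1 p hpw
  · have h1 : ble cs u (M p) := hM.ble_apply hup hpw hu
    have h2 : ble cs (M p) v := by
      have := hM.ble_apply (u := M p) (p := M v) (ble_trans h.ble hp2) hMvw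
        (by rwa [hM.2.1 p hpw])
      rwa [hM.2.1 v hv] at this
    obtain h3 | h3 := huv.2 _ h1 h2
    · left
      rw [← h3, hM.2.1 p hpw]
    · right
      rw [← h3, hM.2.1 p hpw]
  · exfalso
    have h1 : ble cs p v := by
      have := hM.ble_apply hp2 hMvw h
      rwa [hM.2.1 v hv] at this
    obtain h2 | h2 := huv.2 (M u) hu.ble (ble_trans hp1 h1)
    · exact hu.1.2 h2.symm
    · exact hne h2

end SpecialMatching

section AlternatingPaths

variable {W : Type*} {M N : W → W}

/-- The path obtained from `b` by applying `M` and `N` alternately, starting with `M`. -/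
def matchPath (M N : W → W) (b : W) : ℕ → W
  | 0 => b
  | n + 1 => if n % 2 = 0 then M (matchPath M N b n) else N (matchPath M N b n)

theorem matchPath_succ_of_even {b : W} {n : ℕ} (h : n % 2 = 0) :
    matchPath M N b (n + 1) = M (matchPath M N b n) := if_pos h

theorem matchPath_succ_of_odd {b : W} {n : ℕ} (h : n % 2 = 1) :
    matchPath M N b (n + 1) = N (matchPath M N b n) := if_neg (by omega)

theorem orbitMN_trans {u v x : W} (h : v ∈ orbitMN M N u) (h' : x ∈ orbitMN M N v) :
    x ∈ orbitMN M N u := Relation.ReflTransGen.trans h h'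

theorem apply_left_mem_orbitMN {u v : W} (h : v ∈ orbitMN M N u) : M v ∈ orbitMN M N u :=
  Relation.ReflTransGen.tail h (Or.inl rfl)

theorem apply_right_mem_orbitMN {u v : W} (h : v ∈ orbitMN M N u) : N v ∈ orbitMN M N u :=
  Relation.ReflTransGen.tail h (Or.inr rfl)

theorem matchPath_mem_orbitMN {u b : W} (h : b ∈ orbitMN M N u) (n : ℕ) :
    matchPath M N b n ∈ orbitMN M N u ∧ matchPath N M b n ∈ orbitMN M N u := by
  induction n with
  | zero => exact ⟨h, h⟩
  | succ n ih =>
    obtain hn | hn := Nat.mod_two_eq_zero_or_one n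
    · rw [matchPath_succ_of_even hn, matchPath_succ_of_even hn]
      exact ⟨apply_left_mem_orbitMN ih.1, apply_right_mem_orbitMN ih.2⟩
    · rw [matchPath_succ_of_odd hn, matchPath_succ_of_odd hn]
      exact ⟨apply_right_mem_orbitMN ih.1, apply_left_mem_orbitMN ih.2⟩

end AlternatingPaths

section Orbits

variable {B : Type*} {W : Type*} [Group W] {Mat : CoxeterMatrix B} {cs : CoxeterSystem Mat W}
  {w : W} {M N : W → W}

theorem matchPath_ble (hM : IsSpecialMatching cs w M) (hN : IsSpecialMatching cs w N) {b : W}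
    (hb : ble cs b w) (n : ℕ) : ble cs (matchPath M N b n) w := by
  induction n with
  | zero => exact hb
  | succ n ih =>
    obtain h | h := Nat.mod_two_eq_zero_or_one n
    · rw [matchPath_succ_of_even h]
      exact hM.1 _ ih
    · rw [matchPath_succ_of_odd h]
      exact hN.1 _ ih

theorem matchPath_bcov (hM : IsSpecialMatching cs w M) (hN : IsSpecialMatching cs w N) {b : W}
    (hb : ble cs b w) (hbM : bcov cs b (M b)) (hbN : bcov cs b (N b)) (i : ℕ)
    (hne : ∀ j, 1 ≤ j → j ≤ i → matchPath M N b j ≠ matchPath N M b j) :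
    bcov cs (matchPath M N b i) (matchPath M N b (i + 1)) ∧
    bcov cs (matchPath N M b i) (matchPath N M b (i + 1)) ∧
    bcov cs (matchPath M N b i) (matchPath N M b (i + 1)) ∧
    bcov cs (matchPath N M b i) (matchPath M N b (i + 1)) := by
  induction i with
  | zero => exact ⟨hbM, hbN, hbN, hbM⟩
  | succ i ih =>
    obtain ⟨h1, h2, h3, h4⟩ := ih fun j h h' => hne j h (by omega)
    have hd := hne (i + 1) (by omega) le_rfl
    have hy := matchPath_ble hM hN hb (i + 1)
    have hz := matchPath_ble hN hM hb (i + 1)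
    obtain h | h := Nat.mod_two_eq_zero_or_one i
    · have h' : (i + 1) % 2 = 1 := by omega
      rw [matchPath_succ_of_odd (n := i + 1) h', matchPath_succ_of_odd (n := i + 1) h']
      have e1 := matchPath_succ_of_even (M := M) (N := N) (b := b) h
      have e2 := matchPath_succ_of_even (M := N) (N := M) (b := b) h
      have k1 := hM.bcov_of_bcov hz h3 (e1 ▸ h1) (e1 ▸ hd)
      have k2 := hN.bcov_of_bcov hy h4 (e2 ▸ h2) (e2 ▸ hd.symm)
      rw [← e1] at k1
      rw [← e2] at k2
      exact ⟨k2.1, k1.1, k1.2, k2.2⟩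
    · have h' : (i + 1) % 2 = 0 := by omega
      rw [matchPath_succ_of_even (n := i + 1) h', matchPath_succ_of_even (n := i + 1) h']
      have e1 := matchPath_succ_of_odd (M := M) (N := N) (b := b) h
      have e2 := matchPath_succ_of_odd (M := N) (N := M) (b := b) h
      have k1 := hN.bcov_of_bcov hz h3 (e1 ▸ h1) (e1 ▸ hd)
      have k2 := hM.bcov_of_bcov hy h4 (e2 ▸ h2) (e2 ▸ hd.symm)
      rw [← e1] at k1
      rw [← e2] at k2
      exact ⟨k2.1, k1.1, k1.2, k2.2⟩

theorem exists_matchPath_eq (hM : IsSpecialMatching cs w M) (hN : IsSpecialMatching cs w N)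
    {b : W} (hb : ble cs b w) (hbM : bcov cs b (M b)) (hbN : bcov cs b (N b)) :
    ∃ m, 1 ≤ m ∧ matchPath M N b m = matchPath N M b m := by
  by_contra! hne
  have hlen : ∀ i, i ≤ cs.length (matchPath M N b i) := by
    intro i
    induction i with
    | zero => omega
    | succ i ih =>
      have := (matchPath_bcov hM hN hb hbM hbN i fun j h _ => hne j h).1.length_lt
      omega
  have h1 := hlen (cs.length w + 1)
  have h2 := length_le_of_ble (matchPath_ble hM hN hb (cs.length w + 1))
  omega

theorem apply_matchPath (hM : IsSpecialMatching cs w M) (hN : IsSpecialMatching cs w N) {b : W}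
    (hb : ble cs b w) {m : ℕ} (hm : 1 ≤ m) (heq : matchPath M N b m = matchPath N M b m) {i : ℕ}
    (hi : i ≤ m) :
    (∃ j ≤ m, M (matchPath M N b i) = matchPath M N b j ∨
      M (matchPath M N b i) = matchPath N M b j) ∧
    (∃ j ≤ m, N (matchPath M N b i) = matchPath M N b j ∨
      N (matchPath M N b i) = matchPath N M b j) := by
  have hy := matchPath_ble hM hN hb
  have hz := matchPath_ble hN hM hb
  obtain h | h := Nat.mod_two_eq_zero_or_one i
  · constructor
    · obtain hlt | rfl := hi.lt_or_eq
      · exact ⟨i + 1, hlt, Or.inl (matchPath_succ_of_even h).symm⟩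
      · obtain ⟨j, rfl⟩ : ∃ j, i = j + 1 := ⟨i - 1, by omega⟩
        refine ⟨j, by omega, Or.inr ?_⟩
        rw [heq, matchPath_succ_of_odd (by omega), hM.2.1 _ (hz j)]
    · obtain rfl | ⟨j, rfl⟩ : i = 0 ∨ ∃ j, i = j + 1 := by
        obtain _ | j := i
        · exact Or.inl rfl
        · exact Or.inr ⟨j, rfl⟩
      · exact ⟨1, hm, Or.inr rfl⟩
      · refine ⟨j, by omega, Or.inl ?_⟩
        rw [matchPath_succ_of_odd (by omega), hN.2.1 _ (hy j)]
  · obtain ⟨j, rfl⟩ : ∃ j, i = j + 1 := ⟨i - 1, by omega⟩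
    constructor
    · refine ⟨j, by omega, Or.inl ?_⟩
      rw [matchPath_succ_of_even (by omega), hM.2.1 _ (hy j)]
    · obtain hlt | rfl := hi.lt_or_eq
      · exact ⟨j + 1 + 1, hlt, Or.inl (matchPath_succ_of_odd h).symm⟩
      · refine ⟨j, by omega, Or.inr ?_⟩
        rw [heq, matchPath_succ_of_even (by omega), hN.2.1 _ (hz j)]

theorem ble_and_mem_orbitMN_symm (hM : IsSpecialMatching cs w M)
    (hN : IsSpecialMatching cs w N) {u v : W} (hu : ble cs u w) (h : v ∈ orbitMN M N u) :
    ble cs v w ∧ u ∈ orbitMN M N v := by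
  induction h with
  | refl => exact ⟨hu, .refl⟩
  | tail _ hs ih =>
    obtain rfl | rfl := hs
    · exact ⟨hM.1 _ ih.1, .head (Or.inl (hM.2.1 _ ih.1)) ih.2⟩
    · exact ⟨hN.1 _ ih.1, .head (Or.inr (hN.2.1 _ ih.1)) ih.2⟩

theorem orbitMN_eq_matchPath (hM : IsSpecialMatching cs w M) (hN : IsSpecialMatching cs w N)
    {u b : W} (hu : ble cs u w) (hb : b ∈ orbitMN M N u) {m : ℕ} (hm : 1 ≤ m)
    (heq : matchPath M N b m = matchPath N M b m) :
    orbitMN M N u = {x | ∃ i ≤ m, x = matchPath M N b i ∨ x = matchPath N M b i} := by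
  obtain ⟨hbw, hub⟩ := ble_and_mem_orbitMN_symm hM hN hu hb
  ext x
  constructor
  · intro hx
    have hx' : x ∈ orbitMN M N b := orbitMN_trans hub hx
    induction hx' with
    | refl => exact ⟨0, Nat.zero_le _, Or.inl rfl⟩
    | @tail c d hc hs ih =>
      have key : ∀ i ≤ m, c = matchPath M N b i ∨ c = matchPath N M b i →
          ∃ i ≤ m, d = matchPath M N b i ∨ d = matchPath N M b i := by
        rintro i hi (rfl | rfl)
        · have := apply_matchPath hM hN hbw hm heq hi
          obtain rfl | rfl := hs
          · exact this.1
          · exact this.2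
        · have := apply_matchPath hN hM hbw hm heq.symm hi
          obtain rfl | rfl := hs
          · exact this.2.imp fun _ h => ⟨h.1, h.2.symm⟩
          · exact this.1.imp fun _ h => ⟨h.1, h.2.symm⟩
      obtain ⟨i, hi, hci⟩ := ih (orbitMN_trans hb hc)
      exact key i hi hci
  · rintro ⟨i, -, rfl | rfl⟩
    · exact (matchPath_mem_orbitMN hb i).1
    · exact (matchPath_mem_orbitMN hb i).2

theorem exists_minimal_orbitMN (hM : IsSpecialMatching cs w M) (hN : IsSpecialMatching cs w N)
    {u : W} (hu : ble cs u w) :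
    ∃ b ∈ orbitMN M N u, bcov cs b (M b) ∧ bcov cs b (N b) := by
  obtain ⟨b, hb, hmin⟩ := (measure cs.length).wf.has_min (orbitMN M N u) ⟨u, .refl⟩
  have hbw := (ble_and_mem_orbitMN_symm hM hN hu hb).1
  exact ⟨b, hb,
    (hM.2.2.1 b hbw).resolve_left fun h => hmin _ (apply_left_mem_orbitMN hb) h.length_lt,
    (hN.2.2.1 b hbw).resolve_left fun h => hmin _ (apply_right_mem_orbitMN hb) h.length_lt⟩

/-- The poset structure of an orbit `O`: two saturated chains `y` and `z` with common endpoints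
and otherwise disjoint, in which each element of rank `i` is covered by each element of
rank `i + 1`. -/
structure IsDihedral (cs : CoxeterSystem Mat W) (O : Set W) (m : ℕ) (y z : ℕ → W) : Prop where
  one_le : 1 ≤ m
  bot_eq : y 0 = z 0
  top_eq : y m = z m
  ne : ∀ i, 1 ≤ i → i < m → y i ≠ z i
  left : ∀ i < m, bcov cs (y i) (y (i + 1))
  right : ∀ i < m, bcov cs (z i) (z (i + 1))
  left_right : ∀ i < m, bcov cs (y i) (z (i + 1))
  right_left : ∀ i < m, bcov cs (z i) (y (i + 1))
  mem_iff : ∀ x, x ∈ O ↔ ∃ i ≤ m, x = y i ∨ x = z i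

namespace IsDihedral

variable {O : Set W} {m : ℕ} {y z : ℕ → W} {H : Set B}

theorem symm (h : IsDihedral cs O m y z) : IsDihedral cs O m z y where
  one_le := h.one_le
  bot_eq := h.bot_eq.symm
  top_eq := h.top_eq.symm
  ne i h1 h2 := (h.ne i h1 h2).symm
  left := h.right
  right := h.left
  left_right := h.right_left
  right_left := h.left_right
  mem_iff x := by simp only [h.mem_iff, or_comm]

theorem left_mem (h : IsDihedral cs O m y z) {i : ℕ} (hi : i ≤ m) : y i ∈ O :=
  (h.mem_iff _).2 ⟨i, hi, Or.inl rfl⟩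

theorem bot_ble_left (h : IsDihedral cs O m y z) {i : ℕ} (hi : i ≤ m) :
    ble cs (y 0) (y i) := by
  induction i with
  | zero => exact .refl
  | succ i ih => exact ble_trans (ih (by omega)) (h.left i hi).ble

theorem left_ble_top (h : IsDihedral cs O m y z) {i : ℕ} (hi : i ≤ m) :
    ble cs (y i) (y m) := by
  induction hi using Nat.decreasingInduction with
  | self => exact .refl
  | of_succ i hi ih => exact ble_trans (h.left i hi).ble ih

theorem bot_ble (h : IsDihedral cs O m y z) {x : W} (hx : x ∈ O) : ble cs (y 0) x := by
  obtain ⟨i, hi, rfl | rfl⟩ := (h.mem_iff x).1 hx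
  · exact h.bot_ble_left hi
  · exact h.bot_eq ▸ h.symm.bot_ble_left hi

theorem ble_top (h : IsDihedral cs O m y z) {x : W} (hx : x ∈ O) : ble cs x (y m) := by
  obtain ⟨i, hi, rfl | rfl⟩ := (h.mem_iff x).1 hx
  · exact h.left_ble_top hi
  · exact h.top_eq ▸ h.symm.left_ble_top hi

theorem covInB_left (h : IsDihedral cs O m y z) {i : ℕ} (hi : i < m) :
    CovInB cs O (y i) (y (i + 1)) := by
  refine ⟨h.left_mem hi.le, h.left_mem hi, (h.left i hi).1, fun x _ hx => ?_⟩
  obtain h1 | h1 := (h.left i hi).2 x hx.1.1 hx.2.1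
  · exact hx.1.2 h1.symm
  · exact hx.2.2 h1

theorem notMem_WH_of_one_le (hdown : ∀ i < m, z (i + 1) ∈ WH cs H → z i ∈ WH cs H)
    (hz : z 1 ∉ WH cs H) {i : ℕ} (h1 : 1 ≤ i) (hi : i ≤ m) : z i ∉ WH cs H := by
  induction i, h1 using Nat.le_induction with
  | base => exact hz
  | succ i _ ih => exact fun hmem => ih (by omega) (hdown i hi hmem)

theorem mem_WH_of_mem_of_mem (h : IsDihedral cs O m y z) (h0 : y 0 ∈ WH cs H)
    (hy : y 1 ∈ WH cs H) (hz : z 1 ∈ WH cs H) {i : ℕ} (hi : i ≤ m) :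
    y i ∈ WH cs H ∧ z i ∈ WH cs H := by
  induction i with
  | zero => exact ⟨h0, h.bot_eq ▸ h0⟩
  | succ i ih =>
    obtain rfl | hpos := Nat.eq_zero_or_pos i
    · exact ⟨hy, hz⟩
    obtain ⟨h1, h2⟩ := ih (by omega)
    have hne := h.ne i hpos hi
    exact ⟨mem_WH_of_bcov_of_bcov hne (h.left i hi) (h.right_left i hi) h1 h2,
      mem_WH_of_bcov_of_bcov hne (h.left_right i hi) (h.right i hi) h1 h2⟩

theorem left_mem_WH (h : IsDihedral cs O m y z)
    (hzdown : ∀ i < m, z (i + 1) ∈ WH cs H → z i ∈ WH cs H)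
    (h0 : y 0 ∈ WH cs H) (hy : y 1 ∈ WH cs H) (hz : z 1 ∉ WH cs H) {i : ℕ} (hi : i < m) :
    y i ∈ WH cs H := by
  induction i using Nat.strong_induction_on with
  | _ i ih =>
    obtain _ | _ | i := i
    · exact h0
    · exact hy
    by_contra hv
    have hzi : z (i + 1) ∉ WH cs H := notMem_WH_of_one_le hzdown hz (by omega) (by omega)
    have hzi' : z (i + 2) ∉ WH cs H := notMem_WH_of_one_le hzdown hz (by omega) hi.le
    have h1 := ih i (by omega) (by omega)
    have h2 := ih (i + 1) (by omega) (by omega)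
    have hxz := h.left_right i (by omega)
    exact h.ne (i + 2) (by omega) hi
      ((mul_eq_of_bcov_of_notMem_WH hxz (h.left (i + 1) (by omega))
        (h.right_left (i + 1) (by omega)) h1 h2 hzi hv).trans
      (mul_eq_of_bcov_of_notMem_WH hxz (h.left_right (i + 1) (by omega))
        (h.right (i + 1) (by omega)) h1 h2 hzi hzi').symm)

theorem exists_chain (h : IsDihedral cs O m y z)
    (hzdown : ∀ i < m, z (i + 1) ∈ WH cs H → z i ∈ WH cs H)
    (hstep : ∀ i < m, y (i + 1) = M (y i) ∨ y (i + 1) = N (y i))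
    (h0 : y 0 ∈ WH cs H) (hy : y 1 ∈ WH cs H) (hz : z 1 ∉ WH cs H) :
    ∃ b ∈ O, ∃ t ∈ O, ∃ u' : W,
      (∀ x ∈ O, ble cs b x) ∧ (∀ x ∈ O, ble cs x t) ∧ CovInB cs O u' t ∧
      ∃ k : ℕ, ∃ c : ℕ → W, c 0 = b ∧ c k = u' ∧
        (∀ i < k, CovInB cs O (c i) (c (i + 1)) ∧
          (c (i + 1) = M (c i) ∨ c (i + 1) = N (c i))) ∧
        O ∩ WH cs H = c '' {i | i ≤ k} := by
  obtain ⟨k, rfl⟩ : ∃ k, m = k + 1 := ⟨m - 1, by have := h.one_le; omega⟩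
  refine ⟨y 0, h.left_mem (by omega), y (k + 1), h.left_mem le_rfl, y k,
    fun x hx => h.bot_ble hx, fun x hx => h.ble_top hx, h.covInB_left (by omega), k, y, rfl, rfl,
    fun i hi => ⟨h.covInB_left (by omega), hstep i (by omega)⟩, ?_⟩
  ext x
  constructor
  · rintro ⟨hx, hxH⟩
    have hzmem : ∀ i ≤ k + 1, z i ∈ WH cs H → i = 0 := by
      intro i hi hmem
      by_contra hne
      exact notMem_WH_of_one_le hzdown hz (by omega) hi hmem
    obtain ⟨i, hi, rfl | rfl⟩ := (h.mem_iff x).1 hx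
    · refine ⟨i, ?_, rfl⟩
      by_contra hik
      change ¬ i ≤ k at hik
      obtain rfl : i = k + 1 := by omega
      rw [h.top_eq] at hxH
      have := hzmem _ le_rfl hxH
      omega
    · obtain rfl := hzmem i hi hxH
      exact ⟨0, Nat.zero_le _, h.bot_eq⟩
  · rintro ⟨i, hi, rfl⟩
    change i ≤ k at hi
    exact ⟨h.left_mem (by omega), h.left_mem_WH hzdown h0 hy hz (by omega)⟩

end IsDihedral

theorem exists_isDihedral_orbitMN (hM : IsSpecialMatching cs w M)
    (hN : IsSpecialMatching cs w N) {u : W} (hu : ble cs u w) :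
    ∃ m y z, IsDihedral cs (orbitMN M N u) m y z ∧
      (∀ i < m, y (i + 1) = M (y i) ∨ y (i + 1) = N (y i)) ∧
      (∀ i < m, z (i + 1) = M (z i) ∨ z (i + 1) = N (z i)) := by
  classical
  obtain ⟨b, hb, hbM, hbN⟩ := exists_minimal_orbitMN hM hN hu
  have hbw := (ble_and_mem_orbitMN_symm hM hN hu hb).1
  have hex := exists_matchPath_eq hM hN hbw hbM hbN
  obtain ⟨hm, heq⟩ := Nat.find_spec hex
  have hmin : ∀ i, 1 ≤ i → i < Nat.find hex → matchPath M N b i ≠ matchPath N M b i :=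
    fun i h1 hi he => Nat.find_min hex hi ⟨h1, he⟩
  generalize Nat.find hex = m at hm heq hmin
  have hcov : ∀ i < m, _ := fun i hi => matchPath_bcov hM hN hbw hbM hbN i
    fun j h1 hj => hmin j h1 (by omega)
  have hO := orbitMN_eq_matchPath hM hN hu hb hm heq
  have hstep : ∀ (P Q : W → W) (i : ℕ), matchPath P Q b (i + 1) = P (matchPath P Q b i) ∨
      matchPath P Q b (i + 1) = Q (matchPath P Q b i) := by
    intro P Q i
    obtain h | h := Nat.mod_two_eq_zero_or_one i
    · exact Or.inl (matchPath_succ_of_even h)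
    · exact Or.inr (matchPath_succ_of_odd h)
  exact ⟨m, matchPath M N b, matchPath N M b,
    { one_le := hm
      bot_eq := rfl
      top_eq := heq
      ne := hmin
      left := fun i hi => (hcov i hi).1
      right := fun i hi => (hcov i hi).2.1
      left_right := fun i hi => (hcov i hi).2.2.1
      right_left := fun i hi => (hcov i hi).2.2.2
      mem_iff := fun x => by rw [hO]; rfl },
    fun i _ => hstep M N i, fun i _ => (hstep N M i).symm⟩

theorem IsHSpecial.apply_mem_WH {H : Set B} (hM : IsHSpecial cs H w M) {x y : W}
    (hy : ble cs y w) (hxy : bcov cs x y) (he : y = M x) (hyH : y ∈ WH cs H) :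
    x ∈ WH cs H := by
  have hx : M y = x := by rw [he, hM.1.2.1 x (ble_trans hxy.ble hy)]
  have := hM.2 y hy hyH (by rwa [hx])
  rwa [hx] at this

end Orbits

/-- Let `w ∈ W^H` and let `M, N` be `H`-special matchings of `[e,w]`.
For every orbit `O` of `⟨M,N⟩` on `[e,w]`, the set `O ∩ W^H` is: the empty set; or the
entire orbit; or the singleton of the minimum `0̂_O`; or the saturated chain from `0̂_O`
to a coatom `u'` of the maximum `1̂_O` of `O`, each covering step of which is performed
by `M` or by `N`. -/
theorem stmt16 {B : Type*} {W : Type*} [Group W] {Mat : CoxeterMatrix B}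
    (cs : CoxeterSystem Mat W) (H : Set B) (w : W) (hw : w ∈ WH cs H)
    (M N : W → W) (hM : IsHSpecial cs H w M) (hN : IsHSpecial cs H w N)
    (u0 : W) (hu0 : ble cs u0 w) :
    orbitMN M N u0 ∩ WH cs H = ∅ ∨
    orbitMN M N u0 ∩ WH cs H = orbitMN M N u0 ∨
    (∃ b ∈ orbitMN M N u0, (∀ z ∈ orbitMN M N u0, ble cs b z) ∧
      orbitMN M N u0 ∩ WH cs H = {b}) ∨
    (∃ b ∈ orbitMN M N u0, ∃ t ∈ orbitMN M N u0, ∃ u' : W,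
      (∀ z ∈ orbitMN M N u0, ble cs b z) ∧
      (∀ z ∈ orbitMN M N u0, ble cs z t) ∧
      CovInB cs (orbitMN M N u0) u' t ∧
      ∃ k : ℕ, ∃ c : ℕ → W, c 0 = b ∧ c k = u' ∧
        (∀ i < k, CovInB cs (orbitMN M N u0) (c i) (c (i + 1)) ∧
          (c (i + 1) = M (c i) ∨ c (i + 1) = N (c i))) ∧
        orbitMN M N u0 ∩ WH cs H = c '' {i | i ≤ k}) := by
  obtain ⟨m, y, z, h, hy, hz⟩ := exists_isDihedral_orbitMN hM.1 hN.1 hu0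
  have hO : ∀ x ∈ orbitMN M N u0, ble cs x w := fun x hx =>
    (ble_and_mem_orbitMN_symm hM.1 hN.1 hu0 hx).1
  have hydown : ∀ i < m, y (i + 1) ∈ WH cs H → y i ∈ WH cs H := fun i hi hmem =>
    (hy i hi).elim
      (fun he => hM.apply_mem_WH (hO _ (h.left_mem hi)) (h.left i hi) he hmem)
      (fun he => hN.apply_mem_WH (hO _ (h.left_mem hi)) (h.left i hi) he hmem)
  have hzdown : ∀ i < m, z (i + 1) ∈ WH cs H → z i ∈ WH cs H := fun i hi hmem =>
    (hz i hi).elim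
      (fun he => hM.apply_mem_WH (hO _ (h.symm.left_mem hi)) (h.right i hi) he hmem)
      (fun he => hN.apply_mem_WH (hO _ (h.symm.left_mem hi)) (h.right i hi) he hmem)
  by_cases h0 : y 0 ∈ WH cs H
  · have h0' : z 0 ∈ WH cs H := h.bot_eq ▸ h0
    right
    by_cases hy1 : y 1 ∈ WH cs H <;> by_cases hz1 : z 1 ∈ WH cs H
    · left
      refine Set.inter_eq_left.2 fun x hx => ?_
      obtain ⟨i, hi, rfl | rfl⟩ := (h.mem_iff x).1 hx
      · exact (h.mem_WH_of_mem_of_mem h0 hy1 hz1 hi).1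
      · exact (h.mem_WH_of_mem_of_mem h0 hy1 hz1 hi).2
    · exact Or.inr (Or.inr (h.exists_chain hzdown hy h0 hy1 hz1))
    · exact Or.inr (Or.inr (h.symm.exists_chain hydown hz h0' hz1 hy1))
    · right
      left
      refine ⟨y 0, h.left_mem (Nat.zero_le _), fun x hx => h.bot_ble hx, ?_⟩
      refine Set.Subset.antisymm ?_
        (Set.singleton_subset_iff.2 ⟨h.left_mem (Nat.zero_le _), h0⟩)
      rintro x ⟨hx, hxH⟩
      obtain ⟨i, hi, rfl | rfl⟩ := (h.mem_iff x).1 hx <;> obtain rfl | hpos := Nat.eq_zero_or_pos i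
      · rfl
      · exact absurd hxH (IsDihedral.notMem_WH_of_one_le hydown hy1 hpos hi)
      · exact h.bot_eq.symm
      · exact absurd hxH (IsDihedral.notMem_WH_of_one_le hzdown hz1 hpos hi)
  · left
    have hyn : ∀ i ≤ m, y i ∉ WH cs H := by
      intro i hi
      induction i with
      | zero => exact h0
      | succ i ih => exact fun hmem => ih (by omega) (hydown i hi hmem)
    have hzn : ∀ i ≤ m, z i ∉ WH cs H := by
      intro i hi
      induction i with
      | zero => exact h.bot_eq ▸ h0
      | succ i ih => exact fun hmem => ih (by omega) (hzdown i hi hmem)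
    refine Set.eq_empty_iff_forall_notMem.2 fun x ⟨hx, hxH⟩ => ?_
    obtain ⟨i, hi, rfl | rfl⟩ := (h.mem_iff x).1 hx
    · exact hyn i hi hxH
    · exact hzn i hi hxH
end
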